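/- For every η > 0 there is N such that for all n ≥ N the following holds, where k = k₀(n) − 4 and M = f_n(k). In G_{n,1/2}: (i) the expected number of unordered pairs {A, B} of distinct k-element vertex subsets that both induce cliques and satisfy |A ∩ B| ≥ 2 is at most (1+η)·k⁴M²/(2n²); and (ii) the expected number of unordered triples {A, B, C} of distinct k-element vertex subsets, all inducing cliques, with |A ∩ B| ≥ 2, |A ∩ C| ≥ 2 and |B ∩ C| ≥ 2, is at most (1+η)·2k⁶M³/(3n⁴). -/

import Mathlib

/-- `fExp n k` is the expected number of `k`-cliques in `G_{n,1/2}`,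
i.e. `C(n,k) · 2^{-C(k,2)}`. -/
noncomputable def fExp (n k : ℕ) : ℝ := (n.choose k : ℝ) / 2 ^ (k.choose 2)

/-- `kZero n = min {k : fExp n k < 1}`. -/
noncomputable def kZero (n : ℕ) : ℕ := sInf {k | fExp n k < 1}

/-- The number of unordered families of `r` distinct `k`-element vertex subsets of `G`,
each inducing a clique, with any two members sharing at least two vertices. -/
noncomputable def overlapCount (n k r : ℕ) (G : SimpleGraph (Fin n)) : ℕ :=
  Nat.card {P : Finset (Finset (Fin n)) // P.card = r ∧
    (∀ A ∈ P, A.card = k ∧ G.IsClique (A : Set (Fin n))) ∧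
    ∀ A ∈ P, ∀ B ∈ P, A ≠ B → 2 ≤ (A ∩ B).card}

lemma card_simpleGraph_mul_two_pow_le {V : Type*} [Fintype V] [DecidableEq V]
    (E : Finset (Finset V)) (hE : ∀ e ∈ E, e.card = 2) :
    Nat.card {G : SimpleGraph V // ∀ u v, u ≠ v → {u, v} ∈ E → G.Adj u v} * 2 ^ E.card ≤
      Nat.card (SimpleGraph V) := by
  classical
  let f : {G : SimpleGraph V // ∀ u v, u ≠ v → {u, v} ∈ E → G.Adj u v} × E.powerset →
      SimpleGraph V := fun p =>
    { Adj := fun u v => p.1.1.Adj u v ∧ ({u, v} : Finset V) ∉ p.2.1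
      symm := ⟨fun u v h => ⟨h.1.symm, by rw [Finset.pair_comm]; exact h.2⟩⟩
      loopless := ⟨fun u h => p.1.1.loopless.irrefl u h.1⟩ }
  have hf : ∀ p u v, (f p).Adj u v ↔ p.1.1.Adj u v ∧ ({u, v} : Finset V) ∉ p.2.1 :=
    fun _ _ _ => Iff.rfl
  have hsub : ∀ p q, f p = f q → p.2.1 ⊆ q.2.1 := by
    intro p q h e he
    have heE := Finset.mem_powerset.1 p.2.2 he
    obtain ⟨u, v, huv, rfl⟩ := Finset.card_eq_two.1 (hE e heE)
    by_contra hne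
    have : (f q).Adj u v := (hf q u v).2 ⟨q.1.2 u v huv heE, hne⟩
    rw [← h] at this
    exact ((hf p u v).1 this).2 he
  have hle : ∀ p q, f p = f q → ∀ u v, p.1.1.Adj u v → q.1.1.Adj u v := by
    intro p q h u v huv
    by_cases hS : ({u, v} : Finset V) ∈ p.2.1
    · exact q.1.2 u v huv.ne (Finset.mem_powerset.1 p.2.2 hS)
    · have : (f p).Adj u v := (hf p u v).2 ⟨huv, hS⟩
      rw [h] at this
      exact ((hf q u v).1 this).1
  have hinj : Function.Injective f := by
    intro p q h
    refine Prod.ext (Subtype.ext ?_) (Subtype.ext ?_)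
    · ext u v
      exact ⟨hle p q h u v, hle q p h.symm u v⟩
    · exact Finset.Subset.antisymm (hsub p q h) (hsub q p h.symm)
  have := Nat.card_le_card_of_injective f hinj
  rwa [Nat.card_prod, Nat.card_eq_fintype_card (α := E.powerset), Fintype.card_coe,
    Finset.card_powerset] at this

lemma card_simpleGraph_isClique_div_le {V : Type*} [Fintype V] [DecidableEq V]
    (Q : Finset (Finset V)) :
    (Nat.card {G : SimpleGraph V // ∀ A ∈ Q, G.IsClique (A : Set V)} : ℝ) /
      Nat.card (SimpleGraph V) ≤ (1 / 2) ^ (Q.biUnion fun A => A.powersetCard 2).card := by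
  have h := card_simpleGraph_mul_two_pow_le (Q.biUnion fun A => A.powersetCard 2) (by
    intro e he
    obtain ⟨A, -, hA⟩ := Finset.mem_biUnion.1 he
    exact (Finset.mem_powersetCard.1 hA).2)
  have heq : Nat.card {G : SimpleGraph V // ∀ A ∈ Q, G.IsClique (A : Set V)} ≤
      Nat.card {G : SimpleGraph V // ∀ u v, u ≠ v →
        {u, v} ∈ (Q.biUnion fun A => A.powersetCard 2) → G.Adj u v} := by
    refine Nat.card_le_card_of_injective
      (Subtype.map id fun G hG u v huv he => ?_) (Subtype.map_injective _ fun _ _ h => h)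
    obtain ⟨A, hA, hAe⟩ := Finset.mem_biUnion.1 he
    have hs := (Finset.mem_powersetCard.1 hAe).1
    exact hG A hA (hs (by simp)) (hs (by simp)) huv
  have h2 := (Nat.mul_le_mul_right _ heq).trans h
  have hpos : 0 < Nat.card (SimpleGraph V) := Nat.card_pos
  rw [div_le_iff₀ (by exact_mod_cast hpos), one_div, inv_pow, inv_mul_eq_div,
    le_div_iff₀ (by positivity)]
  exact_mod_cast h2

lemma sum_card_isClique_div_le {V ι : Type*} [Fintype V] [DecidableEq V] [Fintype ι]
    [Fintype (SimpleGraph V)] (c : ι → Prop) [DecidablePred c] (Q : ι → Finset (Finset V)) :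
    (∑ G : SimpleGraph V,
      (Nat.card {p : ι // c p ∧ ∀ A ∈ Q p, G.IsClique (A : Set V)} : ℝ)) /
        Nat.card (SimpleGraph V) ≤
      ∑ p with c p, (1 / 2) ^ ((Q p).biUnion fun A => A.powersetCard 2).card := by
  classical
  have h : ∀ G : SimpleGraph V,
      (Nat.card {p : ι // c p ∧ ∀ A ∈ Q p, G.IsClique (A : Set V)} : ℝ) =
      ∑ p with c p, if ∀ A ∈ Q p, G.IsClique (A : Set V) then (1 : ℝ) else 0 := by
    intro G
    rw [Nat.card_eq_fintype_card, Fintype.card_subtype, Finset.sum_boole, Finset.filter_filter]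
  simp_rw [h]
  rw [Finset.sum_comm, Finset.sum_div]
  refine Finset.sum_le_sum fun p _ => ?_
  refine le_trans (le_of_eq ?_) (card_simpleGraph_isClique_div_le (Q p))
  rw [Finset.sum_boole, Nat.card_eq_fintype_card (α := {G : SimpleGraph V // _}),
    Fintype.card_subtype]

lemma mul_card_le_card_of_le_card_fiber {α β : Type*} [DecidableEq α] {s : Finset α}
    {t : Finset β} (f : β → α) (m : ℕ) (h : ∀ a ∈ s, m ≤ (t.filter fun b => f b = a).card) :
    m * s.card ≤ t.card := by
  calc m * s.card = ∑ _a ∈ s, m := by rw [Finset.sum_const, smul_eq_mul, mul_comm]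
    _ ≤ ∑ a ∈ s, (t.filter fun b => f b = a).card := Finset.sum_le_sum h
    _ = (t.filter fun b => f b ∈ s).card := Finset.sum_card_fiberwise_eq_card_filter t s f
    _ ≤ t.card := Finset.card_filter_le _ _

lemma two_mul_overlapCount_le (n k : ℕ) (G : SimpleGraph (Fin n)) :
    2 * overlapCount n k 2 G ≤ Nat.card {p : Finset (Fin n) × Finset (Fin n) //
      (p.1.card = k ∧ p.2.card = k ∧ 2 ≤ (p.1 ∩ p.2).card) ∧
        ∀ A ∈ ({p.1, p.2} : Finset (Finset (Fin n))), G.IsClique (A : Set (Fin n))} := by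
  classical
  unfold overlapCount
  rw [Nat.card_eq_fintype_card, Nat.card_eq_fintype_card, Fintype.card_subtype,
    Fintype.card_subtype]
  refine mul_card_le_card_of_le_card_fiber (fun p => {p.1, p.2}) 2 fun P hP => ?_
  obtain ⟨hc, hcl, hi⟩ := (Finset.mem_filter.1 hP).2
  obtain ⟨A, B, hAB, rfl⟩ := Finset.card_eq_two.1 hc
  have hA := hcl A (by simp)
  have hB := hcl B (by simp)
  have hI := hi A (by simp) B (by simp) hAB
  have h2 : ({(A, B), (B, A)} : Finset (Finset (Fin n) × Finset (Fin n))).card = 2 := by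
    rw [Finset.card_pair]
    simp [hAB]
  refine h2.ge.trans (Finset.card_le_card fun p hp => ?_)
  have hI' : 2 ≤ (B ∩ A).card := by rwa [Finset.inter_comm]
  simp only [Finset.mem_insert, Finset.mem_singleton] at hp
  rcases hp with rfl | rfl <;>
    simp [hA, hB, hI, hI', Finset.pair_comm]

lemma six_mul_overlapCount_le (n k : ℕ) (G : SimpleGraph (Fin n)) :
    6 * overlapCount n k 3 G ≤
      Nat.card {p : Finset (Fin n) × Finset (Fin n) × Finset (Fin n) //
        (p.1.card = k ∧ p.2.1.card = k ∧ p.2.2.card = k ∧ 2 ≤ (p.1 ∩ p.2.1).card ∧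
          2 ≤ (p.1 ∩ p.2.2).card ∧ 2 ≤ (p.2.1 ∩ p.2.2).card) ∧
        ∀ A ∈ ({p.1, p.2.1, p.2.2} : Finset (Finset (Fin n))),
          G.IsClique (A : Set (Fin n))} := by
  classical
  unfold overlapCount
  rw [Nat.card_eq_fintype_card, Nat.card_eq_fintype_card, Fintype.card_subtype,
    Fintype.card_subtype]
  refine mul_card_le_card_of_le_card_fiber (fun p => {p.1, p.2.1, p.2.2}) 6 fun P hP => ?_
  obtain ⟨hc, hcl, hi⟩ := (Finset.mem_filter.1 hP).2
  obtain ⟨A, B, C, hAB, hAC, hBC, rfl⟩ := Finset.card_eq_three.1 hc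
  have hA := hcl A (by simp)
  have hB := hcl B (by simp)
  have hC := hcl C (by simp)
  have h₁ := hi A (by simp) B (by simp) hAB
  have h₂ := hi A (by simp) C (by simp) hAC
  have h₃ := hi B (by simp) C (by simp) hBC
  have h₁' := hi B (by simp) A (by simp) hAB.symm
  have h₂' := hi C (by simp) A (by simp) hAC.symm
  have h₃' := hi C (by simp) B (by simp) hBC.symm
  have h6 : ({(A, B, C), (A, C, B), (B, A, C), (B, C, A), (C, A, B), (C, B, A)} :
      Finset (Finset (Fin n) × Finset (Fin n) × Finset (Fin n))).card = 6 := by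
    simp [hAB, hAC, hBC, hAB.symm, hAC.symm, hBC.symm]
  refine h6.ge.trans (Finset.card_le_card fun p hp => ?_)
  simp only [Finset.mem_insert, Finset.mem_singleton] at hp
  simp only [Finset.mem_filter, Finset.mem_univ, true_and]
  have e₁ : ({A, C, B} : Finset (Finset (Fin n))) = {A, B, C} := by
    rw [Finset.pair_comm]
  have e₂ : ({B, A, C} : Finset (Finset (Fin n))) = {A, B, C} := Finset.insert_comm _ _ _
  have e₃ : ({B, C, A} : Finset (Finset (Fin n))) = {A, B, C} := by
    rw [Finset.pair_comm, e₂]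
  have e₄ : ({C, A, B} : Finset (Finset (Fin n))) = {A, B, C} := by
    rw [Finset.insert_comm, e₁]
  have e₅ : ({C, B, A} : Finset (Finset (Fin n))) = {A, B, C} := by
    rw [Finset.pair_comm, e₄]
  have hcl' : ∀ D ∈ ({A, B, C} : Finset (Finset (Fin n))), G.IsClique (D : Set (Fin n)) :=
    fun D hD => (hcl D hD).2
  rcases hp with rfl | rfl | rfl | rfl | rfl | rfl
  · exact ⟨⟨⟨hA.1, hB.1, hC.1, h₁, h₂, h₃⟩, hcl'⟩, rfl⟩
  · exact ⟨⟨⟨hA.1, hC.1, hB.1, h₂, h₁, h₃'⟩, e₁ ▸ hcl'⟩, e₁⟩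
  · exact ⟨⟨⟨hB.1, hA.1, hC.1, h₁', h₃, h₂⟩, e₂ ▸ hcl'⟩, e₂⟩
  · exact ⟨⟨⟨hB.1, hC.1, hA.1, h₃, h₁', h₂'⟩, e₃ ▸ hcl'⟩, e₃⟩
  · exact ⟨⟨⟨hC.1, hA.1, hB.1, h₂', h₃', h₁⟩, e₄ ▸ hcl'⟩, e₄⟩
  · exact ⟨⟨⟨hC.1, hB.1, hA.1, h₃', h₂', h₁'⟩, e₅ ▸ hcl'⟩, e₅⟩

lemma card_powersetCard_union_add {α : Type*} [DecidableEq α] (A B : Finset α) :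
    (A.powersetCard 2 ∪ B.powersetCard 2).card + (A ∩ B).card.choose 2 =
      A.card.choose 2 + B.card.choose 2 := by
  have h : A.powersetCard 2 ∩ B.powersetCard 2 = (A ∩ B).powersetCard 2 := by
    ext e
    simp only [Finset.mem_inter, Finset.mem_powersetCard, Finset.subset_inter_iff]
    tauto
  rw [← Finset.card_powersetCard 2 (A ∩ B), ← h, Finset.card_union_add_card_inter,
    Finset.card_powersetCard, Finset.card_powersetCard]

lemma card_powersetCard_union_union_add {α : Type*} [DecidableEq α] (A B C : Finset α) :
    (A.powersetCard 2 ∪ (B.powersetCard 2 ∪ C.powersetCard 2)).card +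
        ((A ∩ B).card.choose 2 + (A ∩ C).card.choose 2 + (B ∩ C).card.choose 2) =
      A.card.choose 2 + B.card.choose 2 + C.card.choose 2 + (C ∩ (A ∩ B)).card.choose 2 := by
  have hi : ∀ A B : Finset α,
      A.powersetCard 2 ∩ B.powersetCard 2 = (A ∩ B).powersetCard 2 := by
    intro A B
    ext e
    simp only [Finset.mem_inter, Finset.mem_powersetCard, Finset.subset_inter_iff]
    tauto
  have h₁ := Finset.card_union_add_card_inter (A.powersetCard 2)
    (B.powersetCard 2 ∪ C.powersetCard 2)
  rw [Finset.inter_union_distrib_left, hi, hi, Finset.card_powersetCard] at h₁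
  have h₂ := card_powersetCard_union_add B C
  have h₃ := card_powersetCard_union_add (A ∩ B) (A ∩ C)
  have h₄ : A ∩ B ∩ (A ∩ C) = C ∩ (A ∩ B) := by
    ext e
    simp only [Finset.mem_inter]
    tauto
  rw [h₄] at h₃
  omega

lemma choose_two_add_choose_two_add_mul (t x y : ℕ) :
    (t + x).choose 2 + (t + y).choose 2 + x * y = t.choose 2 + (t + x + y).choose 2 := by
  induction y with
  | zero => simp [add_comm]
  | succ y ih =>
    rw [← add_assoc, ← add_assoc, Nat.choose_succ_succ' (t + y) 1,
      Nat.choose_succ_succ' (t + x + y) 1, Nat.choose_one_right, Nat.choose_one_right, mul_add_one]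
    simp only [Nat.reduceAdd]
    omega

lemma card_filter_subset_mul_choose {α : Type*} [Fintype α] [DecidableEq α] (U : Finset α)
    (k : ℕ) :
    ((Finset.univ.powersetCard k).filter fun C => U ⊆ C).card *
        (Fintype.card α).choose U.card ≤ (Fintype.card α).choose k * k.choose U.card := by
  by_cases hk : U.card ≤ k
  · have h : ((Finset.univ.powersetCard k).filter fun C => U ⊆ C).card ≤
        (Fintype.card α - U.card).choose (k - U.card) := by
      rw [← Finset.card_compl, ← Finset.card_powersetCard]
      refine Finset.card_le_card_of_injOn (fun C => C \ U) (fun C hC => ?_) ?_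
      · simp only [Finset.coe_filter, Finset.mem_powersetCard, Set.mem_ofPred_eq] at hC
        rw [Finset.mem_coe, Finset.mem_powersetCard]
        refine ⟨fun x hx => ?_, ?_⟩
        · simp only [Finset.mem_sdiff] at hx
          simpa using hx.2
        · rw [Finset.card_sdiff_of_subset hC.2, hC.1.2]
      · intro C hC D hD h
        simp only [Finset.coe_filter, Set.mem_ofPred_eq] at hC hD
        have h' : C \ U = D \ U := h
        rw [← Finset.sdiff_union_of_subset hC.2, h', Finset.sdiff_union_of_subset hD.2]
    rw [Nat.choose_mul hk, mul_comm]
    exact Nat.mul_le_mul_left _ h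
  · have h : ((Finset.univ.powersetCard k).filter fun C => U ⊆ C) = ∅ := by
      refine Finset.filter_eq_empty_iff.2 fun C hC hUC => hk ?_
      rw [← (Finset.mem_powersetCard.1 hC).2]
      exact Finset.card_le_card hUC
    simp [h]

lemma sum_powersetCard_inter_le {α : Type*} [Fintype α] [DecidableEq α] (k : ℕ)
    {T X Y : Finset α} (hTX : Disjoint T X) (hTY : Disjoint T Y) (hXY : Disjoint X Y)
    (F : ℕ → ℕ → ℕ → ℝ) (hF : ∀ t x y, 0 ≤ F t x y) :
    ∑ C ∈ Finset.univ.powersetCard k, F (C ∩ T).card (C ∩ X).card (C ∩ Y).card ≤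
      (Fintype.card α).choose k * ∑ t ∈ Finset.range (T.card + 1),
        ∑ x ∈ Finset.range (X.card + 1), ∑ y ∈ Finset.range (Y.card + 1),
          (T.card.choose t * X.card.choose x * Y.card.choose y : ℝ) *
            ((k.choose (t + x + y) : ℝ) / (Fintype.card α).choose (t + x + y)) * F t x y := by
  have hfib : ∀ p ∈ T.powerset ×ˢ X.powerset ×ˢ Y.powerset,
      (((Finset.univ.powersetCard k).filter fun C => (C ∩ T, C ∩ X, C ∩ Y) = p).card : ℝ) ≤
        (Fintype.card α).choose k * ((k.choose (p.1.card + p.2.1.card + p.2.2.card) : ℝ) /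
          (Fintype.card α).choose (p.1.card + p.2.1.card + p.2.2.card)) := by
    rintro ⟨T', X', Y'⟩ hp
    simp only [Finset.mem_product, Finset.mem_powerset] at hp
    obtain ⟨hT, hX, hY⟩ := hp
    have hcard : (T' ∪ X' ∪ Y').card = T'.card + X'.card + Y'.card := by
      rw [Finset.card_union_of_disjoint, Finset.card_union_of_disjoint]
      · exact Finset.disjoint_of_subset_left hT (Finset.disjoint_of_subset_right hX hTX)
      · rw [Finset.disjoint_union_left]
        exact ⟨Finset.disjoint_of_subset_left hT (Finset.disjoint_of_subset_right hY hTY),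
          Finset.disjoint_of_subset_left hX (Finset.disjoint_of_subset_right hY hXY)⟩
    have h₁ := card_filter_subset_mul_choose (T' ∪ X' ∪ Y') k
    rw [hcard] at h₁
    have hpos : 0 < (Fintype.card α).choose (T'.card + X'.card + Y'.card) := by
      rw [← hcard]
      exact Nat.choose_pos (Finset.card_le_univ _)
    rw [← mul_div_assoc, le_div_iff₀ (by exact_mod_cast hpos)]
    rw [← Nat.cast_le (α := ℝ), Nat.cast_mul, Nat.cast_mul] at h₁
    refine le_trans ?_ h₁
    gcongr with C hC
    intro h
    simp only [Prod.mk.injEq] at h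
    obtain ⟨rfl, rfl, rfl⟩ := h
    exact Finset.union_subset (Finset.union_subset Finset.inter_subset_left
      Finset.inter_subset_left) Finset.inter_subset_left
  have hmaps : ∀ C ∈ Finset.univ.powersetCard k,
      (C ∩ T, C ∩ X, C ∩ Y) ∈ T.powerset ×ˢ X.powerset ×ˢ Y.powerset := by
    intro C _
    simp only [Finset.mem_product, Finset.mem_powerset]
    exact ⟨Finset.inter_subset_right, Finset.inter_subset_right, Finset.inter_subset_right⟩
  rw [← Finset.sum_fiberwise_of_maps_to' hmaps
    (fun p => F p.1.card p.2.1.card p.2.2.card)]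
  simp_rw [Finset.sum_const, nsmul_eq_mul]
  calc _ ≤ ∑ p ∈ T.powerset ×ˢ X.powerset ×ˢ Y.powerset,
        ((Fintype.card α).choose k * ((k.choose (p.1.card + p.2.1.card + p.2.2.card) : ℝ) /
          (Fintype.card α).choose (p.1.card + p.2.1.card + p.2.2.card))) *
            F p.1.card p.2.1.card p.2.2.card :=
        Finset.sum_le_sum fun p hp => mul_le_mul_of_nonneg_right (hfib p hp) (hF _ _ _)
    _ = _ := by
      simp_rw [Finset.sum_product]
      have hY : ∀ t x, ∑ V ∈ Y.powerset,
          ((Fintype.card α).choose k * ((k.choose (t + x + V.card) : ℝ) /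
            (Fintype.card α).choose (t + x + V.card))) * F t x V.card = _ :=
        fun t x => Finset.sum_powerset_apply_card (fun y =>
          ((Fintype.card α).choose k * ((k.choose (t + x + y) : ℝ) /
            (Fintype.card α).choose (t + x + y))) * F t x y)
      simp_rw [hY]
      have hX : ∀ t, ∑ V ∈ X.powerset, ∑ y ∈ Finset.range (Y.card + 1), Y.card.choose y •
          (((Fintype.card α).choose k * ((k.choose (t + V.card + y) : ℝ) /
            (Fintype.card α).choose (t + V.card + y))) * F t V.card y) = _ :=
        fun t => Finset.sum_powerset_apply_card (fun x =>
          ∑ y ∈ Finset.range (Y.card + 1), Y.card.choose y •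
          (((Fintype.card α).choose k * ((k.choose (t + x + y) : ℝ) /
            (Fintype.card α).choose (t + x + y))) * F t x y))
      simp_rw [hX]
      rw [Finset.sum_powerset_apply_card (fun t => ∑ x ∈ Finset.range (X.card + 1),
        X.card.choose x • ∑ y ∈ Finset.range (Y.card + 1), Y.card.choose y •
          (((Fintype.card α).choose k * ((k.choose (t + x + y) : ℝ) /
            (Fintype.card α).choose (t + x + y))) * F t x y))]
      simp_rw [nsmul_eq_mul, Finset.mul_sum]
      refine Finset.sum_congr rfl fun t _ => Finset.sum_congr rfl fun x _ =>
        Finset.sum_congr rfl fun y _ => ?_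
      ring

lemma sum_powersetCard_inter_le_single {α : Type*} [Fintype α] [DecidableEq α] (k : ℕ)
    (A : Finset α) (F : ℕ → ℝ) (hF : ∀ t, 0 ≤ F t) :
    ∑ B ∈ Finset.univ.powersetCard k, F (A ∩ B).card ≤
      (Fintype.card α).choose k * ∑ t ∈ Finset.range (A.card + 1),
        (A.card.choose t : ℝ) * ((k.choose t : ℝ) / (Fintype.card α).choose t) * F t := by
  have h := sum_powersetCard_inter_le k (Finset.disjoint_empty_right A)
    (Finset.disjoint_empty_right A) (Finset.disjoint_empty_right ∅) (fun t _ _ => F t)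
    (fun t _ _ => hF t)
  simpa [Finset.inter_comm] using h

lemma choose_mul_pow_le_choose_mul_pow {n k : ℕ} (hkn : k ≤ n) (u : ℕ) :
    k.choose u * n ^ u ≤ n.choose u * k ^ u := by
  have h : k.descFactorial u * n ^ u ≤ n.descFactorial u * k ^ u := by
    induction u with
    | zero => simp
    | succ u ih =>
      have h₁ : (k - u) * n ≤ (n - u) * k := by
        rw [Nat.sub_mul, Nat.sub_mul, mul_comm n k]
        exact Nat.sub_le_sub_left (Nat.mul_le_mul_left _ hkn) _
      rw [Nat.descFactorial_succ, Nat.descFactorial_succ, pow_succ, pow_succ]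
      calc (k - u) * k.descFactorial u * (n ^ u * n)
          = ((k - u) * n) * (k.descFactorial u * n ^ u) := by ring
        _ ≤ ((n - u) * k) * (n.descFactorial u * k ^ u) := Nat.mul_le_mul h₁ ih
        _ = _ := by ring
  rw [Nat.descFactorial_eq_factorial_mul_choose, Nat.descFactorial_eq_factorial_mul_choose,
    mul_assoc, mul_assoc] at h
  exact Nat.le_of_mul_le_mul_left h (Nat.factorial_pos u)

lemma choose_div_choose_le {n k : ℕ} (hkn : k ≤ n) (hn : 0 < n) (u : ℕ) :
    (k.choose u : ℝ) / n.choose u ≤ ((k : ℝ) / n) ^ u := by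
  by_cases hu : u ≤ n
  · have hpos : (0 : ℝ) < n.choose u := by exact_mod_cast Nat.choose_pos hu
    have hn' : (0 : ℝ) < n := by exact_mod_cast hn
    rw [div_pow, div_le_div_iff₀ hpos (by positivity), mul_comm ((k : ℝ) ^ u)]
    exact_mod_cast choose_mul_pow_le_choose_mul_pow hkn u
  · rw [Nat.choose_eq_zero_of_lt (not_le.1 hu)]
    simp only [Nat.cast_zero, div_zero]
    positivity

/-- For `|A ∩ B| = a` and `|A| = |B| = k`, the total contribution, relative to `C(n,k)`, of the
`k`-sets meeting `A ∩ B`, `A \ B` and `B \ A` in `t`, `x` and `y` vertices. -/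
noncomputable def extWeight (n k a t x y : ℕ) : ℝ :=
  (a.choose t * (k - a).choose x * (k - a).choose y : ℝ) *
    ((k.choose (t + x + y) : ℝ) / n.choose (t + x + y)) *
      (2 ^ (t + x + y).choose 2 / 2 ^ (x * y))

lemma extWeight_nonneg (n k a t x y : ℕ) : 0 ≤ extWeight n k a t x y := by
  unfold extWeight
  positivity

lemma extWeight_swap (n k a t x y : ℕ) : extWeight n k a t x y = extWeight n k a t y x := by
  unfold extWeight
  rw [add_right_comm t x y, mul_comm x y]
  ring

lemma extWeight_le_of_three_mul_le {n k a t x y : ℕ} (hkn : k ≤ n) (hn : 0 < n) (hak : a ≤ k)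
    (h3 : 3 ≤ t + x + y) (hu : 3 * (t + x + y) ≤ k)
    (hsmall : ∀ u, 3 * u ≤ k → k ^ 2 * 2 ^ u ≤ n) :
    extWeight n k a t x y ≤ 8 * (k : ℝ) ^ 6 / (n : ℝ) ^ 3 := by
  have hn' : (0 : ℝ) < n := by exact_mod_cast hn
  have hv : ∀ u, 3 ≤ u → 3 * u ≤ k →
      ((k : ℝ) ^ 2 / n) ^ u * 2 ^ u.choose 2 ≤ 8 * (k : ℝ) ^ 6 / (n : ℝ) ^ 3 := by
    intro u hu
    induction u, hu using Nat.le_induction with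
    | base =>
      intro _
      have : Nat.choose 3 2 = 3 := rfl
      rw [this, div_pow]
      apply le_of_eq
      ring
    | succ u hu ih =>
      intro hk
      have hs : (k : ℝ) ^ 2 * 2 ^ u ≤ n := by exact_mod_cast hsmall u (by omega)
      refine le_trans ?_ (ih (by omega))
      rw [Nat.choose_succ_succ' u 1, Nat.choose_one_right, pow_succ, pow_add]
      calc ((k : ℝ) ^ 2 / n) ^ u * ((k : ℝ) ^ 2 / n) * (2 ^ u * 2 ^ u.choose 2)
          = (((k : ℝ) ^ 2 / n) ^ u * 2 ^ u.choose 2) * ((k : ℝ) ^ 2 * 2 ^ u / n) := by ring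
        _ ≤ (((k : ℝ) ^ 2 / n) ^ u * 2 ^ u.choose 2) * 1 := by
          gcongr
          rw [div_le_one hn']
          exact hs
        _ = _ := mul_one _
  refine le_trans ?_ (hv _ h3 hu)
  have hc : ∀ m i, m ≤ k → (m.choose i : ℝ) ≤ (k : ℝ) ^ i := by
    intro m i hm
    exact_mod_cast (Nat.choose_le_pow m i).trans (Nat.pow_le_pow_left hm i)
  unfold extWeight
  calc _ ≤ ((k : ℝ) ^ t * (k : ℝ) ^ x * (k : ℝ) ^ y) * ((k : ℝ) / n) ^ (t + x + y) *
        (2 ^ (t + x + y).choose 2 / 1) := by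
        gcongr
        · exact hc _ _ hak
        · exact hc _ _ (Nat.sub_le _ _)
        · exact hc _ _ (Nat.sub_le _ _)
        · exact choose_div_choose_le hkn hn _
        · exact one_le_pow₀ (by norm_num)
    _ = _ := by
      rw [← pow_add, ← pow_add, ← mul_pow, div_one]
      congr 2
      ring

lemma choose_mul_choose_le (a d t y : ℕ) :
    a.choose t * d.choose y ≤ (a + d).choose (t + y) := by
  rw [Nat.add_choose_eq]
  exact Finset.single_le_sum (f := fun p : ℕ × ℕ => a.choose p.1 * d.choose p.2)
    (fun _ _ => Nat.zero_le _) (a := (t, y)) (by simp)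

lemma choose_mul_choose_mul_choose_le {k a t x y s : ℕ} (hak : a ≤ k) (huk : t + x + y ≤ k)
    (hxy : x ≤ y) (hs : k ≤ 2 ^ s) :
    a.choose t * (k - a).choose x * (k - a).choose y ≤
      k ^ (k - (t + x + y)) * 2 ^ s ^ 2 * 2 ^ (x * y) := by
  have h₁ : a.choose t * (k - a).choose y ≤ k ^ (k - (t + x + y)) * k ^ x := by
    refine (choose_mul_choose_le _ _ _ _).trans ?_
    rw [Nat.add_sub_cancel' hak, ← Nat.choose_symm (by omega), ← pow_add,
      show k - (t + x + y) + x = k - (t + y) by omega]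
    exact Nat.choose_le_pow _ _
  have h₂ : (k - a).choose x ≤ k ^ x :=
    (Nat.choose_le_pow _ _).trans (Nat.pow_le_pow_left (Nat.sub_le _ _) _)
  have h₃ : k ^ x * k ^ x ≤ 2 ^ s ^ 2 * 2 ^ (x * y) := by
    calc k ^ x * k ^ x ≤ (2 ^ s) ^ x * (2 ^ s) ^ x := by gcongr
      _ = 2 ^ (2 * s * x) := by rw [← pow_mul, ← pow_add]; ring_nf
      _ ≤ 2 ^ (s ^ 2 + x * y) := by
        gcongr
        · norm_num
        · have : x * x ≤ x * y := Nat.mul_le_mul_left _ hxy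
          have := two_mul_le_add_sq s x
          nlinarith
      _ = _ := pow_add _ _ _
  calc _ = (a.choose t * (k - a).choose y) * (k - a).choose x := by ring
    _ ≤ (k ^ (k - (t + x + y)) * k ^ x) * k ^ x := Nat.mul_le_mul h₁ h₂
    _ = k ^ (k - (t + x + y)) * (k ^ x * k ^ x) := by ring
    _ ≤ k ^ (k - (t + x + y)) * (2 ^ s ^ 2 * 2 ^ (x * y)) := Nat.mul_le_mul_left _ h₃
    _ = _ := by ring

lemma two_mul_choose_two_add (m : ℕ) : 2 * m.choose 2 + m = m ^ 2 := by
  induction m with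
  | zero => rfl
  | succ m ih =>
    rw [Nat.choose_succ_succ' m 1, Nat.choose_one_right]
    nlinarith

lemma pow_mul_two_pow_choose_le {c u j : ℕ} (h : 2 * c ^ 2 ≤ 2 ^ (2 * u + j)) (hu : 0 < u) :
    c ^ j * 2 ^ u.choose 2 ≤ 2 ^ (u + j).choose 2 := by
  have h' : c ^ 2 ≤ 2 ^ (2 * u + j - 1) := by
    rw [show 2 * u + j = (2 * u + j - 1) + 1 by omega, pow_succ 2 (2 * u + j - 1)] at h
    omega
  refine (Nat.pow_le_pow_iff_left (two_ne_zero)).1 ?_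
  calc (c ^ j * 2 ^ u.choose 2) ^ 2 = (c ^ 2) ^ j * 2 ^ (2 * u.choose 2) := by
        rw [mul_pow, ← pow_mul, ← pow_mul, ← pow_mul, mul_comm j 2, mul_comm 2 (u.choose 2)]
    _ ≤ (2 ^ (2 * u + j - 1)) ^ j * 2 ^ (2 * u.choose 2) := by gcongr
    _ = 2 ^ ((2 * u + j - 1) * j + 2 * u.choose 2) := by rw [← pow_mul, ← pow_add]
    _ = (2 ^ (u + j).choose 2) ^ 2 := by
      rw [← pow_mul]
      congr 1
      obtain ⟨v, rfl⟩ : ∃ v, u = v + 1 := ⟨u - 1, by omega⟩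
      have h₁ := two_mul_choose_two_add (v + 1)
      have h₂ := two_mul_choose_two_add (v + 1 + j)
      rw [show 2 * (v + 1) + j - 1 = 2 * v + 1 + j by omega]
      nlinarith

lemma extWeight_le_of_le_three_mul {n k a t x y s : ℕ} (hkn : k ≤ n) (hak : a ≤ k)
    (hu : 0 < t + x + y) (huk : t + x + y ≤ k) (hs : k ≤ 2 ^ s)
    (hlarge : 2 * (k * n) ^ 2 ≤ 2 ^ (k + (t + x + y))) :
    extWeight n k a t x y ≤ 2 ^ s ^ 2 / fExp n k := by
  wlog hxy : x ≤ y generalizing x y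
  · rw [extWeight_swap]
    refine this ?_ ?_ ?_ (by omega)
    all_goals first | omega | rwa [add_right_comm]
  have h₁ := choose_mul_choose_mul_choose_le hak huk hxy hs
  unfold extWeight fExp
  set u := t + x + y with hu'
  obtain ⟨j, rfl⟩ : ∃ j, k = u + j := ⟨k - u, by omega⟩
  have hC : (0 : ℝ) < n.choose (u + j) := by exact_mod_cast Nat.choose_pos hkn
  have hCu : (0 : ℝ) < n.choose u := by exact_mod_cast Nat.choose_pos (huk.trans hkn)
  have h₂ : ((u + j).choose u : ℝ) / n.choose u ≤ (n : ℝ) ^ j / n.choose (u + j) := by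
    rw [div_le_div_iff₀ hCu hC]
    have := Nat.choose_mul (n := n) huk
    have h' : (n - u).choose (u + j - u) ≤ n ^ j := by
      rw [Nat.add_sub_cancel_left]
      exact (Nat.choose_le_pow _ _).trans (Nat.pow_le_pow_left (Nat.sub_le _ _) _)
    have h'' : (u + j).choose u * n.choose (u + j) ≤ n ^ j * n.choose u := by
      rw [mul_comm, this, mul_comm]
      exact Nat.mul_le_mul_right _ h'
    exact_mod_cast h''
  have h₃ : (((u + j : ℕ) : ℝ) * n) ^ j * 2 ^ u.choose 2 ≤ 2 ^ (u + j).choose 2 := by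
    exact_mod_cast pow_mul_two_pow_choose_le (c := (u + j) * n) (u := u) (j := j)
      (by rwa [show 2 * u + j = u + j + u by ring]) hu
  rw [Nat.add_sub_cancel_left] at h₁
  have h₁' : (a.choose t * (u + j - a).choose x * (u + j - a).choose y : ℝ) ≤
      ((u + j : ℕ) : ℝ) ^ j * 2 ^ s ^ 2 * 2 ^ (x * y) := by exact_mod_cast h₁
  calc _ ≤ (((u + j : ℕ) : ℝ) ^ j * 2 ^ s ^ 2 * 2 ^ (x * y)) *
        ((n : ℝ) ^ j / n.choose (u + j)) * (2 ^ u.choose 2 / 2 ^ (x * y)) := by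
        gcongr
    _ = 2 ^ s ^ 2 * ((((u + j : ℕ) : ℝ) * n) ^ j * 2 ^ u.choose 2) / n.choose (u + j) := by
        rw [mul_pow]
        field_simp
    _ ≤ 2 ^ s ^ 2 * 2 ^ (u + j).choose 2 / n.choose (u + j) := by gcongr
    _ = _ := by rw [div_div_eq_mul_div]

lemma fExp_lt_one_iff (n k : ℕ) : fExp n k < 1 ↔ n.choose k < 2 ^ k.choose 2 := by
  unfold fExp
  rw [div_lt_one (by positivity)]
  exact_mod_cast Iff.rfl

lemma fExp_succ_mul_le (n k : ℕ) : fExp n (k + 1) * 2 ^ k ≤ fExp n k * n := by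
  have h : n.choose (k + 1) ≤ n.choose k * n := by
    calc n.choose (k + 1) ≤ n.choose (k + 1) * (k + 1) := Nat.le_mul_of_pos_right _ k.succ_pos
      _ = n.choose k * (n - k) := Nat.choose_succ_right_eq n k
      _ ≤ n.choose k * n := Nat.mul_le_mul_left _ (Nat.sub_le _ _)
  have h' : (n.choose (k + 1) : ℝ) ≤ n.choose k * n := by exact_mod_cast h
  unfold fExp
  rw [Nat.choose_succ_succ' k 1, Nat.choose_one_right, pow_add]
  calc _ = (n.choose (k + 1) : ℝ) / 2 ^ k.choose 2 := by field_simp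
    _ ≤ n.choose k * n / 2 ^ k.choose 2 := by gcongr
    _ = _ := by ring

lemma fExp_self_lt_one {n : ℕ} (hn : 2 ≤ n) : fExp n n < 1 := by
  rw [fExp_lt_one_iff, Nat.choose_self]
  exact Nat.one_lt_two_pow (Nat.choose_pos hn).ne'

lemma fExp_kZero_lt_one {n : ℕ} (hn : 2 ≤ n) : fExp n (kZero n) < 1 :=
  Nat.sInf_mem (s := {k | fExp n k < 1}) ⟨n, fExp_self_lt_one hn⟩

lemma kZero_le {n : ℕ} (hn : 2 ≤ n) : kZero n ≤ n :=
  Nat.sInf_le (s := {k | fExp n k < 1}) (fExp_self_lt_one hn)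

lemma one_le_fExp_of_lt_kZero {n k : ℕ} (hk : k < kZero n) : 1 ≤ fExp n k :=
  not_lt.1 fun h => Nat.notMem_of_lt_sInf hk h

lemma kZero_pos {n : ℕ} (hn : 2 ≤ n) : 0 < kZero n := by
  rcases Nat.eq_zero_or_pos (kZero n) with h | h
  · have := fExp_kZero_lt_one hn
    rw [h, fExp_lt_one_iff] at this
    simp at this
  · exact h

lemma sq_le_kZero_sq_mul {n : ℕ} (hn : 2 ≤ n) :
    n ^ 2 ≤ kZero n ^ 2 * 2 ^ (kZero n - 1) := by
  have hlt := (fExp_lt_one_iff _ _).1 (fExp_kZero_lt_one hn)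
  have hle := choose_mul_pow_le_choose_mul_pow (kZero_le hn) (kZero n)
  have hpos := kZero_pos hn
  set m := kZero n
  rw [Nat.choose_self, one_mul] at hle
  refine (Nat.pow_le_pow_iff_left hpos.ne').1 ?_
  have hexp : 2 * m.choose 2 = (m - 1) * m := by
    have := two_mul_choose_two_add m
    obtain ⟨q, hq⟩ : ∃ q, m = q + 1 := ⟨m - 1, by omega⟩
    rw [hq] at this ⊢
    rw [Nat.add_sub_cancel]
    nlinarith
  calc (n ^ 2) ^ m = (n ^ m) ^ 2 := by rw [← pow_mul, ← pow_mul, mul_comm]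
    _ ≤ (2 ^ m.choose 2 * m ^ m) ^ 2 := by
      gcongr
      exact hle.trans (Nat.mul_le_mul_right _ hlt.le)
    _ = m ^ (m * 2) * 2 ^ (2 * m.choose 2) := by
      rw [mul_pow, ← pow_mul, ← pow_mul, mul_comm 2 (m.choose 2), mul_comm]
    _ = (m ^ 2 * 2 ^ (m - 1)) ^ m := by
      rw [hexp, mul_pow, ← pow_mul, ← pow_mul, mul_comm m 2]

lemma two_pow_sub_le_sq {n p : ℕ} (hp : 0 < p) (h : 1 ≤ fExp n p) : 2 ^ (p - 1) ≤ n ^ 2 := by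
  have hle : 2 ^ p.choose 2 ≤ n.choose p := by
    rw [← not_lt, ← fExp_lt_one_iff]
    exact not_lt.2 h
  refine (Nat.pow_le_pow_iff_left hp.ne').1 ?_
  have hexp : 2 * p.choose 2 = (p - 1) * p := by
    have := two_mul_choose_two_add p
    obtain ⟨q, rfl⟩ : ∃ q, p = q + 1 := ⟨p - 1, by omega⟩
    rw [Nat.add_sub_cancel]
    nlinarith
  calc (2 ^ (p - 1)) ^ p = (2 ^ p.choose 2) ^ 2 := by
        rw [← pow_mul, ← pow_mul, ← hexp, mul_comm]
    _ ≤ (n ^ p) ^ 2 := Nat.pow_le_pow_left (hle.trans (Nat.choose_le_pow _ _)) 2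
    _ = (n ^ 2) ^ p := by rw [← pow_mul, ← pow_mul, mul_comm]

lemma five_le_kZero {n : ℕ} (hn : 12 ≤ n) : 5 ≤ kZero n := by
  by_contra! h
  have h₁ := sq_le_kZero_sq_mul (n := n) (by omega)
  have h₂ : kZero n ^ 2 * 2 ^ (kZero n - 1) ≤ 4 ^ 2 * 2 ^ 3 := by
    gcongr
    · omega
    · norm_num
    · omega
  nlinarith

lemma kZero_sub_four_bounds {n k : ℕ} (hn : 12 ≤ n) (hk : k = kZero n - 4) :
    1 ≤ k ∧ k ≤ n ∧ 2 ^ k ≤ n ^ 2 ∧ n ^ 2 ≤ 8 * (k + 4) ^ 2 * 2 ^ k ∧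
      (n : ℝ) ^ 3 ≤ fExp n k * (8 * ((k : ℝ) + 4) ^ 2) ^ 3 := by
  have h5 := five_le_kZero hn
  have hm : kZero n = k + 4 := by omega
  have hlow : n ^ 2 ≤ 8 * (k + 4) ^ 2 * 2 ^ k := by
    have := sq_le_kZero_sq_mul (n := n) (by omega)
    rw [hm, show k + 4 - 1 = k + 3 by omega, pow_add] at this
    linarith
  have hone : 1 ≤ fExp n (k + 3) := one_le_fExp_of_lt_kZero (by omega)
  refine ⟨by omega, (Nat.sub_le _ _).trans (kZero_le (by omega)) |> hk.le.trans, ?_, hlow, ?_⟩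
  · refine le_trans ?_ (two_pow_sub_le_sq (by omega) hone)
    exact Nat.pow_le_pow_right (by norm_num) (by omega)
  · have hn0 : (0 : ℝ) < n := by
      exact_mod_cast (show 0 < n by omega)
    have h₁ := fExp_succ_mul_le n k
    have h₂ := fExp_succ_mul_le n (k + 1)
    have h₃ := fExp_succ_mul_le n (k + 2)
    have hp : (1 : ℝ) ≤ 2 ^ k := one_le_pow₀ (by norm_num)
    have hM : ((2 : ℝ) ^ k) ^ 3 ≤ fExp n k * n ^ 3 := by
      calc ((2 : ℝ) ^ k) ^ 3 ≤ 1 * (2 ^ (k + 2)) * 2 ^ (k + 1) * 2 ^ k := by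
            rw [pow_add, pow_add]
            nlinarith [pow_pos (show (0 : ℝ) < 2 ^ k by positivity) 3]
        _ ≤ fExp n (k + 2 + 1) * (2 ^ (k + 2)) * 2 ^ (k + 1) * 2 ^ k := by gcongr
        _ ≤ fExp n (k + 2) * n * 2 ^ (k + 1) * 2 ^ k := by gcongr
        _ = (fExp n (k + 1 + 1) * 2 ^ (k + 1)) * n * 2 ^ k := by ring
        _ ≤ (fExp n (k + 1) * n) * n * 2 ^ k := by gcongr
        _ = (fExp n (k + 1) * 2 ^ k) * n ^ 2 := by ring
        _ ≤ (fExp n k * n) * n ^ 2 := by gcongr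
        _ = _ := by ring
    have hlow' : (n : ℝ) ^ 2 ≤ 8 * ((k : ℝ) + 4) ^ 2 * 2 ^ k := by exact_mod_cast hlow
    have h6 : (n : ℝ) ^ 3 * n ^ 3 ≤ fExp n k * (8 * ((k : ℝ) + 4) ^ 2) ^ 3 * n ^ 3 := by
      calc (n : ℝ) ^ 3 * n ^ 3 = (n ^ 2) ^ 3 := by ring
        _ ≤ (8 * ((k : ℝ) + 4) ^ 2 * 2 ^ k) ^ 3 := by gcongr
        _ = (8 * ((k : ℝ) + 4) ^ 2) ^ 3 * (2 ^ k) ^ 3 := by ring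
        _ ≤ (8 * ((k : ℝ) + 4) ^ 2) ^ 3 * (fExp n k * n ^ 3) := by gcongr
        _ = _ := by ring
    exact le_of_mul_le_mul_right h6 (by positivity)

lemma exists_forall_le_two_pow_and_le (c : ℕ) :
    ∃ K : ℕ, ∀ k, K ≤ k → ∃ s : ℕ, k ≤ 2 ^ s ∧ 2 * (s ^ 2 + 12 * s + 40 + c) ≤ k := by
  have ht := tendsto_pow_const_div_const_pow_of_one_lt 2 (show (1 : ℝ) < 2 by norm_num)
  have hε : (0 : ℝ) < 1 / (136 + 2 * c) := by positivity
  obtain ⟨L, hL⟩ := Filter.eventually_atTop.1 (ht.eventually (gt_mem_nhds hε))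
  refine ⟨2 ^ (L + 1), fun k hk => ⟨Nat.log 2 k + 1, (Nat.lt_pow_succ_log_self (by norm_num) k).le,
    ?_⟩⟩
  have hk0 : k ≠ 0 := by
    have : 0 < 2 ^ (L + 1) := by positivity
    omega
  have hlog : L + 1 ≤ Nat.log 2 k := (Nat.le_log_iff_pow_le (by norm_num) hk0).2 hk
  refine le_trans ?_ (Nat.pow_log_le_self 2 hk0)
  set m := Nat.log 2 k
  have h := hL m (by omega)
  rw [div_lt_div_iff₀ (by positivity) (by positivity), one_mul] at h
  have h' : m ^ 2 * (136 + 2 * c) < 2 ^ m := by exact_mod_cast h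
  have hm : 1 ≤ m := by omega
  have hm2 : m ≤ m ^ 2 := by nlinarith
  have hm3 : 1 ≤ m ^ 2 := by nlinarith
  have : c ≤ m ^ 2 * c := Nat.le_mul_of_pos_left _ hm3
  nlinarith

/-- The numerator of the bound `errNum k s / n ^ 3` for the weights `extWeight n k a t x y` with
`3 ≤ t + x + y`. -/
def errNum (k s : ℕ) : ℕ := 2 ^ s ^ 2 * (8 * (k + 4) ^ 2) ^ 3 + 8 * k ^ 6

lemma two_pow_mul_errNum_le {n k s c : ℕ} (hs : k ≤ 2 ^ s)
    (hsk : 2 * (s ^ 2 + 12 * s + 40 + c) ≤ k) (hkn : 2 ^ k ≤ n ^ 2) :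
    2 ^ c * ((k + 1) ^ 3 * errNum k s) ≤ n := by
  have hs1 : 1 ≤ 2 ^ s := Nat.one_le_two_pow
  have h₄ : k + 4 ≤ 2 ^ (s + 3) := by
    rw [pow_add]
    omega
  have hW : errNum k s ≤ 2 ^ (s ^ 2 + 6 * s + 28) := by
    calc errNum k s ≤ 2 ^ s ^ 2 * (8 * (2 ^ (s + 3)) ^ 2) ^ 3 + 8 * (2 ^ s) ^ 6 := by
          unfold errNum
          gcongr
      _ = 2 ^ (s ^ 2 + 6 * s + 27) + 2 ^ (6 * s + 3) := by
          have : (8 : ℕ) = 2 ^ 3 := rfl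
          rw [this]
          ring
      _ ≤ 2 ^ (s ^ 2 + 6 * s + 27) + 2 ^ (s ^ 2 + 6 * s + 27) := by
          have := Nat.pow_le_pow_right (show 0 < 2 by norm_num)
            (show 6 * s + 3 ≤ s ^ 2 + 6 * s + 27 by nlinarith)
          omega
      _ = _ := by ring
  refine (Nat.pow_le_pow_iff_left two_ne_zero).1 (le_trans ?_ hkn)
  calc (2 ^ c * ((k + 1) ^ 3 * errNum k s)) ^ 2
      ≤ (2 ^ c * ((2 ^ (s + 3)) ^ 3 * 2 ^ (s ^ 2 + 6 * s + 28))) ^ 2 := by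
        gcongr
        omega
    _ = 2 ^ (2 * (s ^ 2 + 9 * s + 37 + c)) := by ring
    _ ≤ 2 ^ k := by
        gcongr
        · norm_num
        · omega

lemma extWeight_le_errNum_div {n k a t x y s : ℕ} (hk : 1 ≤ k) (hkn : k ≤ n) (hak : a ≤ k)
    (hs : k ≤ 2 ^ s) (hsk : 2 * (s ^ 2 + 12 * s + 40) ≤ k) (hup : 2 ^ k ≤ n ^ 2)
    (hlow : n ^ 2 ≤ 8 * (k + 4) ^ 2 * 2 ^ k)
    (hM : (n : ℝ) ^ 3 ≤ fExp n k * (8 * ((k : ℝ) + 4) ^ 2) ^ 3) (hu : 3 ≤ t + x + y) :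
    extWeight n k a t x y ≤ errNum k s / (n : ℝ) ^ 3 := by
  have hn : (0 : ℝ) < n := by exact_mod_cast (show 0 < n by omega)
  have hs1 : 1 ≤ 2 ^ s := Nat.one_le_two_pow
  have h₄ : k + 4 ≤ 2 ^ (s + 3) := by
    rw [pow_add]
    omega
  rcases lt_or_ge k (t + x + y) with huk | huk
  · have : extWeight n k a t x y = 0 := by
      unfold extWeight
      rw [Nat.choose_eq_zero_of_lt huk]
      simp
    rw [this]
    positivity
  rcases le_or_gt (3 * (t + x + y)) k with h | h
  · refine (extWeight_le_of_three_mul_le hkn (by omega) hak hu h fun u hu => ?_).trans ?_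
    · refine (Nat.pow_le_pow_iff_left (two_ne_zero)).1 (le_trans ?_ hup)
      refine (Nat.pow_le_pow_iff_left (three_ne_zero)).1 ?_
      calc ((k ^ 2 * 2 ^ u) ^ 2) ^ 3 ≤ (((2 ^ s) ^ 2 * 2 ^ u) ^ 2) ^ 3 := by gcongr
        _ = 2 ^ (12 * s + 2 * (3 * u)) := by ring
        _ ≤ 2 ^ (k * 3) := by
          gcongr
          · norm_num
          · nlinarith
        _ = _ := by rw [pow_mul]
    · gcongr
      unfold errNum
      push_cast
      have : (0 : ℝ) ≤ 2 ^ s ^ 2 * (8 * ((k : ℝ) + 4) ^ 2) ^ 3 := by positivity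
      linarith
  · have hlarge : 2 * (k * n) ^ 2 ≤ 2 ^ (k + (t + x + y)) := by
      have h₁ : 16 * k ^ 2 * (k + 4) ^ 2 ≤ 2 ^ (t + x + y) := by
        refine (Nat.pow_le_pow_iff_left (three_ne_zero)).1 ?_
        calc (16 * k ^ 2 * (k + 4) ^ 2) ^ 3
            ≤ (16 * (2 ^ s) ^ 2 * (2 ^ (s + 3)) ^ 2) ^ 3 := by gcongr
          _ = 2 ^ (12 * s + 30) := by
            have : (16 : ℕ) = 2 ^ 4 := rfl
            rw [this]
            ring
          _ ≤ 2 ^ ((t + x + y) * 3) := by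
            gcongr
            · norm_num
            · nlinarith
          _ = _ := by rw [pow_mul]
      calc 2 * (k * n) ^ 2 = 2 * k ^ 2 * n ^ 2 := by ring
        _ ≤ 2 * k ^ 2 * (8 * (k + 4) ^ 2 * 2 ^ k) := by gcongr
        _ = 2 ^ k * (16 * k ^ 2 * (k + 4) ^ 2) := by ring
        _ ≤ 2 ^ k * 2 ^ (t + x + y) := by gcongr
        _ = _ := (pow_add _ _ _).symm
    refine (extWeight_le_of_le_three_mul hkn hak (by omega) huk hs hlarge).trans ?_
    have hMpos : 0 < fExp n k := by
      unfold fExp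
      have : (0 : ℝ) < n.choose k := by exact_mod_cast Nat.choose_pos hkn
      positivity
    rw [div_le_div_iff₀ hMpos (by positivity)]
    unfold errNum
    push_cast
    calc (2 : ℝ) ^ s ^ 2 * n ^ 3
        ≤ 2 ^ s ^ 2 * (fExp n k * (8 * ((k : ℝ) + 4) ^ 2) ^ 3) := by gcongr
      _ ≤ 2 ^ s ^ 2 * (fExp n k * (8 * ((k : ℝ) + 4) ^ 2) ^ 3) + 8 * k ^ 6 * fExp n k :=
        le_add_of_nonneg_right (by positivity)
      _ = _ := by ring

lemma extWeight_two_le {n k a : ℕ} (hkn : k ≤ n) (hn : 0 < n) :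
    extWeight n k a 2 0 0 ≤ a.choose 2 * (2 * ((k : ℝ) / n) ^ 2) := by
  have h := choose_div_choose_le hkn hn 2
  unfold extWeight
  simp only [add_zero, Nat.choose_zero_right, Nat.cast_one, mul_one, mul_zero, pow_zero, div_one,
    Nat.choose_self, pow_one]
  calc _ ≤ (a.choose 2 : ℝ) * ((k : ℝ) / n) ^ 2 * 2 := by gcongr
    _ = _ := by ring

lemma choose_two_mul_two_le {k a : ℕ} (hak : a ≤ k) : (a.choose 2 : ℝ) * 2 ≤ (k : ℝ) ^ 2 := by
  have h : a.choose 2 * 2 ≤ k ^ 2 := by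
    have := two_mul_choose_two_add a
    have := Nat.pow_le_pow_left hak 2
    omega
  exact_mod_cast h

lemma extWeight_two_le_pow {n k a : ℕ} (hkn : k ≤ n) (hn : 0 < n) (hak : a ≤ k) :
    extWeight n k a 2 0 0 ≤ (k : ℝ) ^ 4 / (n : ℝ) ^ 2 := by
  refine (extWeight_two_le hkn hn).trans ?_
  calc (a.choose 2 : ℝ) * (2 * ((k : ℝ) / n) ^ 2) = (a.choose 2 * 2) * ((k : ℝ) / n) ^ 2 := by ring
    _ ≤ (k : ℝ) ^ 2 * ((k : ℝ) / n) ^ 2 := by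
      gcongr
      exact choose_two_mul_two_le hak
    _ = _ := by ring

lemma sum_extWeight_le {n k a : ℕ} {δ : ℝ} (hδ : 0 ≤ δ) (hak : a ≤ k)
    (h : ∀ t x y, 3 ≤ t + x + y → extWeight n k a t x y ≤ δ) :
    ∑ t ∈ Finset.range (a + 1), ∑ x ∈ Finset.range (k - a + 1), ∑ y ∈ Finset.range (k - a + 1),
        (if 2 ≤ t + x ∧ 2 ≤ t + y then extWeight n k a t x y else 0) ≤
      extWeight n k a 2 0 0 + (k + 1) ^ 3 * δ := by
  have h0 := extWeight_nonneg n k a 2 0 0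
  calc _ ≤ ∑ t ∈ Finset.range (a + 1), ∑ x ∈ Finset.range (k - a + 1),
        ∑ y ∈ Finset.range (k - a + 1),
          ((if t = 2 then if x = 0 then if y = 0 then extWeight n k a 2 0 0 else 0 else 0 else 0) +
            δ) := by
        gcongr with t _ x _ y _
        by_cases hc : 2 ≤ t + x ∧ 2 ≤ t + y
        · rw [if_pos hc]
          by_cases hu : 3 ≤ t + x + y
          · refine (h t x y hu).trans (le_add_of_nonneg_left ?_)
            split_ifs <;> first | exact h0 | exact le_rfl
          · obtain ⟨rfl, rfl, rfl⟩ : t = 2 ∧ x = 0 ∧ y = 0 := by omega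
            simpa using hδ
        · rw [if_neg hc]
          refine add_nonneg ?_ hδ
          split_ifs <;> first | exact h0 | exact le_rfl
    _ ≤ extWeight n k a 2 0 0 + ((a + 1 : ℕ) : ℝ) * ((k - a + 1 : ℕ) * ((k - a + 1 : ℕ) * δ)) := by
        simp_rw [Finset.sum_add_distrib]
        refine add_le_add ?_ (by simp)
        have h₁ : ∀ t x : ℕ, ∑ y ∈ Finset.range (k - a + 1),
            (if t = 2 then if x = 0 then if y = 0 then extWeight n k a 2 0 0 else 0 else 0 else 0) =
            if t = 2 then if x = 0 then extWeight n k a 2 0 0 else 0 else 0 := by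
          intro t x
          split_ifs <;> simp
        have h₂ : ∀ t : ℕ, ∑ x ∈ Finset.range (k - a + 1),
            (if t = 2 then if x = 0 then extWeight n k a 2 0 0 else 0 else 0) =
            if t = 2 then extWeight n k a 2 0 0 else 0 := by
          intro t
          split_ifs <;> simp
        simp_rw [h₁, h₂]
        rw [Finset.sum_ite_eq']
        split_ifs
        · exact le_rfl
        · exact h0
    _ ≤ extWeight n k a 2 0 0 + ((k + 1 : ℕ) : ℝ) * ((k + 1 : ℕ) * ((k + 1 : ℕ) * δ)) := by
        gcongr <;> omega
    _ = _ := by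
        push_cast
        ring

lemma sum_extWeight_self_le {n k : ℕ} {δ : ℝ} (R : ℕ → ℝ) {r₂ r : ℝ} (hδ : 0 ≤ δ)
    (hr₂ : 0 ≤ r₂) (hR : ∀ a ≤ k, R a ≤ r) (hR₂ : R 2 ≤ r₂) (hr : 0 ≤ r)
    (h : ∀ t, 3 ≤ t → extWeight n k k t 0 0 ≤ δ) :
    ∑ a ∈ Finset.range (k + 1), (if 2 ≤ a then extWeight n k k a 0 0 * R a else 0) ≤
      extWeight n k k 2 0 0 * r₂ + (k + 1) * (δ * r) := by
  have h0 := extWeight_nonneg n k k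
  calc _ ≤ ∑ a ∈ Finset.range (k + 1),
        ((if a = 2 then extWeight n k k 2 0 0 * r₂ else 0) + δ * r) := by
        refine Finset.sum_le_sum fun a ha => ?_
        have hak : a ≤ k := by
          have := Finset.mem_range.1 ha
          omega
        have hδr := mul_nonneg hδ hr
        have h2r := mul_nonneg (h0 2 0 0) hr₂
        rcases lt_trichotomy a 2 with h2 | rfl | h2
        · rw [if_neg (by omega), if_neg (by omega), zero_add]
          exact hδr
        · rw [if_pos le_rfl, if_pos rfl]
          have := mul_le_mul_of_nonneg_left hR₂ (h0 2 0 0)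
          linarith
        · rw [if_pos h2.le, if_neg (by omega), zero_add]
          exact (mul_le_mul_of_nonneg_left (hR a hak) (h0 a 0 0)).trans
            (mul_le_mul_of_nonneg_right (h a h2) hr)
    _ ≤ _ := by
        rw [Finset.sum_add_distrib, Finset.sum_ite_eq', Finset.sum_const, Finset.card_range,
          nsmul_eq_mul]
        push_cast
        gcongr
        split_ifs
        · exact le_rfl
        · exact mul_nonneg (h0 2 0 0) hr₂

lemma one_half_pow_eq {N p q r : ℕ} (h : N + p = q + r) :
    (1 / 2 : ℝ) ^ N = 2 ^ p / (2 ^ r * 2 ^ q) := by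
  rw [one_div, inv_pow, eq_div_iff (by positivity), ← pow_add, inv_mul_eq_div,
    div_eq_iff (by positivity), ← pow_add]
  congr 1
  omega

lemma sum_pairs_le (n k : ℕ) :
    ∑ p : Finset (Fin n) × Finset (Fin n) with
        p.1.card = k ∧ p.2.card = k ∧ 2 ≤ (p.1 ∩ p.2).card,
      (1 / 2 : ℝ) ^ (({p.1, p.2} : Finset (Finset (Fin n))).biUnion
        fun A => A.powersetCard 2).card ≤
      fExp n k ^ 2 *
        ∑ a ∈ Finset.range (k + 1), (if 2 ≤ a then extWeight n k k a 0 0 * 1 else 0) := by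
  classical
  set F : ℕ → ℝ := fun a => if 2 ≤ a then 2 ^ a.choose 2 else 0 with hF
  have hF0 : ∀ a, 0 ≤ F a := by
    intro a
    simp only [hF]
    split_ifs <;> positivity
  calc _ = ∑ A ∈ Finset.univ.powersetCard k, ∑ B ∈ Finset.univ.powersetCard k,
        F (A ∩ B).card / (2 ^ k.choose 2) ^ 2 := by
        rw [← Finset.sum_product', Finset.sum_filter, ← Finset.sum_subset
          (Finset.subset_univ (Finset.univ.powersetCard k ×ˢ Finset.univ.powersetCard k))]
        · refine Finset.sum_congr rfl fun p hp => ?_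
          simp only [Finset.mem_product, Finset.mem_powersetCard, Finset.subset_univ,
            true_and] at hp
          simp only [hp.1, hp.2, true_and, hF]
          split_ifs with h2
          · have := card_powersetCard_union_add p.1 p.2
            rw [hp.1, hp.2] at this
            rw [Finset.biUnion_insert, Finset.singleton_biUnion, sq]
            exact one_half_pow_eq this
          · simp
        · intro p _ hp
          rw [if_neg]
          rintro ⟨h₁, h₂, -⟩
          exact hp (by simp [h₁, h₂])
    _ ≤ ∑ A ∈ (Finset.univ : Finset (Fin n)).powersetCard k, (n.choose k *
          ∑ a ∈ Finset.range (k + 1), (k.choose a : ℝ) * ((k.choose a : ℝ) / n.choose a) * F a) /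
            (2 ^ k.choose 2) ^ 2 := by
        refine Finset.sum_le_sum fun A hA => ?_
        rw [← Finset.sum_div]
        gcongr
        have h := sum_powersetCard_inter_le_single k A F hF0
        rwa [(Finset.mem_powersetCard.1 hA).2, Fintype.card_fin] at h
    _ = _ := by
        rw [Finset.sum_const, Finset.card_powersetCard, Finset.card_univ, Fintype.card_fin,
          nsmul_eq_mul, fExp, div_pow]
        have : ∀ a : ℕ, (k.choose a : ℝ) * ((k.choose a : ℝ) / n.choose a) * F a =
            if 2 ≤ a then extWeight n k k a 0 0 * 1 else 0 := by
          intro a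
          simp only [hF, extWeight]
          split_ifs <;> simp
        simp_rw [this]
        ring

/-- The total of `extWeight n k a t x y` over the triples for which the third set meets each of
the first two in at least two vertices. -/
noncomputable def extTotal (n k a : ℕ) : ℝ :=
  ∑ t ∈ Finset.range (a + 1), ∑ x ∈ Finset.range (k - a + 1), ∑ y ∈ Finset.range (k - a + 1),
    (if 2 ≤ t + x ∧ 2 ≤ t + y then extWeight n k a t x y else 0)

lemma extTotal_nonneg (n k a : ℕ) : 0 ≤ extTotal n k a := by
  refine Finset.sum_nonneg fun t _ => Finset.sum_nonneg fun x _ => Finset.sum_nonneg fun y _ => ?_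
  split_ifs
  · exact extWeight_nonneg _ _ _ _ _ _
  · exact le_rfl

lemma card_inter_eq_add {α : Type*} [DecidableEq α] (A B C : Finset α) :
    (A ∩ C).card = (C ∩ (A ∩ B)).card + (C ∩ (A \ B)).card := by
  rw [← Finset.card_union_of_disjoint]
  · congr 1
    ext v
    simp only [Finset.mem_inter, Finset.mem_union, Finset.mem_sdiff]
    tauto
  · exact (Finset.disjoint_sdiff_inter A B).symm.mono Finset.inter_subset_right
      Finset.inter_subset_right

lemma sum_third_le {n k : ℕ} {A B : Finset (Fin n)} (hA : A.card = k) (hB : B.card = k) :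
    ∑ C ∈ Finset.univ.powersetCard k, (if 2 ≤ (A ∩ C).card ∧ 2 ≤ (B ∩ C).card then
        (1 / 2 : ℝ) ^ (A.powersetCard 2 ∪ (B.powersetCard 2 ∪ C.powersetCard 2)).card else 0) ≤
      n.choose k * extTotal n k (A ∩ B).card * 2 ^ (A ∩ B).card.choose 2 /
        (2 ^ k.choose 2) ^ 3 := by
  set F : ℕ → ℕ → ℕ → ℝ := fun t x y =>
    if 2 ≤ t + x ∧ 2 ≤ t + y then 2 ^ (t + x + y).choose 2 / 2 ^ (x * y) else 0 with hF
  have hF0 : ∀ t x y, 0 ≤ F t x y := by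
    intro t x y
    simp only [hF]
    split_ifs <;> positivity
  have hAB : (A \ B).card = k - (A ∩ B).card := by
    have := Finset.card_sdiff_add_card_inter A B
    omega
  have hBA : (B \ A).card = k - (A ∩ B).card := by
    have := Finset.card_sdiff_add_card_inter B A
    rw [Finset.inter_comm] at this
    omega
  have h := sum_powersetCard_inter_le k (Finset.disjoint_sdiff_inter A B).symm
    (T := A ∩ B) (X := A \ B) (Y := B \ A)
    (by rw [Finset.inter_comm]; exact (Finset.disjoint_sdiff_inter B A).symm)
    (disjoint_sdiff_sdiff) F hF0
  rw [hAB, hBA, Fintype.card_fin] at h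
  calc _ = ∑ C ∈ Finset.univ.powersetCard k,
        F (C ∩ (A ∩ B)).card (C ∩ (A \ B)).card (C ∩ (B \ A)).card *
          (2 ^ (A ∩ B).card.choose 2 / (2 ^ k.choose 2) ^ 3) := by
        refine Finset.sum_congr rfl fun C hC => ?_
        have hC := (Finset.mem_powersetCard.1 hC).2
        have h₁ := card_inter_eq_add A B C
        have h₂ := card_inter_eq_add B A C
        rw [Finset.inter_comm B A] at h₂
        have h₃ := card_powersetCard_union_union_add A B C
        rw [h₁, h₂, hA, hB, hC] at h₃
        have h₄ := choose_two_add_choose_two_add_mul (C ∩ (A ∩ B)).card (C ∩ (A \ B)).card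
          (C ∩ (B \ A)).card
        simp only [hF, h₁, h₂]
        split_ifs with hc
        · rw [one_half_pow_eq
            (p := (A ∩ B).card.choose 2 + ((C ∩ (A ∩ B)).card + (C ∩ (A \ B)).card +
              (C ∩ (B \ A)).card).choose 2)
            (q := (C ∩ (A \ B)).card * (C ∩ (B \ A)).card) (r := k.choose 2 * 3) (by omega),
            pow_add, ← pow_mul]
          field_simp
        · simp
    _ ≤ _ := by
        rw [← Finset.sum_mul, mul_div_assoc]
        refine mul_le_mul_of_nonneg_right (h.trans (le_of_eq ?_)) (by positivity)
        unfold extTotal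
        congr 1
        refine Finset.sum_congr rfl fun t _ => Finset.sum_congr rfl fun x _ =>
          Finset.sum_congr rfl fun y _ => ?_
        simp only [hF, extWeight]
        split_ifs <;> simp

lemma sum_triples_le (n k : ℕ) :
    ∑ p : Finset (Fin n) × Finset (Fin n) × Finset (Fin n) with
        p.1.card = k ∧ p.2.1.card = k ∧ p.2.2.card = k ∧ 2 ≤ (p.1 ∩ p.2.1).card ∧
          2 ≤ (p.1 ∩ p.2.2).card ∧ 2 ≤ (p.2.1 ∩ p.2.2).card,
      (1 / 2 : ℝ) ^ (({p.1, p.2.1, p.2.2} : Finset (Finset (Fin n))).biUnion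
        fun A => A.powersetCard 2).card ≤
      fExp n k ^ 3 * ∑ a ∈ Finset.range (k + 1),
        (if 2 ≤ a then extWeight n k k a 0 0 * extTotal n k a else 0) := by
  classical
  set F : ℕ → ℝ := fun a => if 2 ≤ a then extTotal n k a * 2 ^ a.choose 2 else 0 with hF
  have hF0 : ∀ a, 0 ≤ F a := by
    intro a
    have := extTotal_nonneg n k a
    simp only [hF]
    split_ifs <;> positivity
  calc _ = ∑ A ∈ Finset.univ.powersetCard k, ∑ B ∈ Finset.univ.powersetCard k,
        ∑ C ∈ Finset.univ.powersetCard k, (if 2 ≤ (A ∩ B).card then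
          (if 2 ≤ (A ∩ C).card ∧ 2 ≤ (B ∩ C).card then (1 / 2 : ℝ) ^
            (A.powersetCard 2 ∪ (B.powersetCard 2 ∪ C.powersetCard 2)).card else 0) else 0) := by
        have hprod : ∀ (S : Finset (Finset (Fin n)))
            (f : Finset (Fin n) → Finset (Fin n) → Finset (Fin n) → ℝ),
            ∑ A ∈ S, ∑ B ∈ S, ∑ C ∈ S, f A B C =
              ∑ p ∈ S ×ˢ S ×ˢ S, f p.1 p.2.1 p.2.2 := by
          intro S f
          simp_rw [Finset.sum_product]
        rw [hprod]
        rw [Finset.sum_filter, ← Finset.sum_subset (Finset.subset_univ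
          (Finset.univ.powersetCard k ×ˢ Finset.univ.powersetCard k ×ˢ
            Finset.univ.powersetCard k))]
        · refine Finset.sum_congr rfl fun p hp => ?_
          simp only [Finset.mem_product, Finset.mem_powersetCard, Finset.subset_univ,
            true_and] at hp
          simp only [hp.1, hp.2.1, hp.2.2, true_and, Finset.biUnion_insert,
            Finset.singleton_biUnion]
          rw [ite_and]
        · intro p _ hp
          rw [if_neg]
          rintro ⟨h₁, h₂, h₃, -⟩
          exact hp (by simp [h₁, h₂, h₃])
    _ ≤ ∑ A ∈ (Finset.univ : Finset (Fin n)).powersetCard k, ∑ B ∈ Finset.univ.powersetCard k,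
        F (A ∩ B).card * (n.choose k / (2 ^ k.choose 2) ^ 3) := by
        refine Finset.sum_le_sum fun A hA => Finset.sum_le_sum fun B hB => ?_
        simp only [hF]
        split_ifs
        · refine (sum_third_le (Finset.mem_powersetCard.1 hA).2
            (Finset.mem_powersetCard.1 hB).2).trans (le_of_eq ?_)
          ring
        · simp
    _ ≤ ∑ A ∈ (Finset.univ : Finset (Fin n)).powersetCard k, (n.choose k *
          ∑ a ∈ Finset.range (k + 1), (k.choose a : ℝ) * ((k.choose a : ℝ) / n.choose a) * F a) *
            (n.choose k / (2 ^ k.choose 2) ^ 3) := by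
        refine Finset.sum_le_sum fun A hA => ?_
        rw [← Finset.sum_mul]
        gcongr
        have h := sum_powersetCard_inter_le_single k A F hF0
        rwa [(Finset.mem_powersetCard.1 hA).2, Fintype.card_fin] at h
    _ = _ := by
        rw [Finset.sum_const, Finset.card_powersetCard, Finset.card_univ, Fintype.card_fin,
          nsmul_eq_mul, fExp, div_pow]
        have : ∀ a : ℕ, (k.choose a : ℝ) * ((k.choose a : ℝ) / n.choose a) * F a =
            if 2 ≤ a then extWeight n k k a 0 0 * extTotal n k a else 0 := by
          intro a
          simp only [hF, extWeight]
          split_ifs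
          · simp
            ring
          · simp
        simp_rw [this]
        ring

lemma expected_pairs_le (n k : ℕ) [Fintype (SimpleGraph (Fin n))] :
    (∑ G : SimpleGraph (Fin n), (overlapCount n k 2 G : ℝ)) / Nat.card (SimpleGraph (Fin n)) ≤
      fExp n k ^ 2 * (∑ a ∈ Finset.range (k + 1),
        (if 2 ≤ a then extWeight n k k a 0 0 * 1 else 0)) / 2 := by
  classical
  have h := (sum_card_isClique_div_le
    (fun p : Finset (Fin n) × Finset (Fin n) =>
      p.1.card = k ∧ p.2.card = k ∧ 2 ≤ (p.1 ∩ p.2).card)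
    (fun p => {p.1, p.2})).trans (sum_pairs_le n k)
  rw [le_div_iff₀ two_pos]
  refine le_trans (le_of_eq_of_le (div_mul_eq_mul_div _ _ _) ?_) h
  rw [Finset.sum_mul]
  gcongr with G
  have := two_mul_overlapCount_le n k G
  rw [mul_comm]
  exact_mod_cast this

lemma expected_triples_le (n k : ℕ) [Fintype (SimpleGraph (Fin n))] :
    (∑ G : SimpleGraph (Fin n), (overlapCount n k 3 G : ℝ)) / Nat.card (SimpleGraph (Fin n)) ≤
      fExp n k ^ 3 * (∑ a ∈ Finset.range (k + 1),
        (if 2 ≤ a then extWeight n k k a 0 0 * extTotal n k a else 0)) / 6 := by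
  classical
  have h := (sum_card_isClique_div_le
    (fun p : Finset (Fin n) × Finset (Fin n) × Finset (Fin n) =>
      p.1.card = k ∧ p.2.1.card = k ∧ p.2.2.card = k ∧ 2 ≤ (p.1 ∩ p.2.1).card ∧
          2 ≤ (p.1 ∩ p.2.2).card ∧ 2 ≤ (p.2.1 ∩ p.2.2).card)
    (fun p => {p.1, p.2.1, p.2.2})).trans (sum_triples_le n k)
  rw [le_div_iff₀ (by norm_num)]
  refine le_trans (le_of_eq_of_le (div_mul_eq_mul_div _ _ _) ?_) h
  rw [Finset.sum_mul]
  gcongr with G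
  have := six_mul_overlapCount_le n k G
  rw [mul_comm]
  exact_mod_cast this

lemma exists_le_kZero_sub_four (K : ℕ) : ∃ N : ℕ, ∀ n, N ≤ n → 12 ≤ n ∧ K ≤ kZero n - 4 := by
  refine ⟨max 12 (8 * (K + 4) ^ 2 * 2 ^ K + 1), fun n hn => ?_⟩
  have h12 : 12 ≤ n := (le_max_left _ _).trans hn
  have hK : 8 * (K + 4) ^ 2 * 2 ^ K + 1 ≤ n := (le_max_right _ _).trans hn
  refine ⟨h12, ?_⟩
  by_contra! h
  obtain ⟨-, -, -, hlow, -⟩ := kZero_sub_four_bounds h12 rfl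
  have : 8 * (kZero n - 4 + 4) ^ 2 * 2 ^ (kZero n - 4) ≤ 8 * (K + 4) ^ 2 * 2 ^ K := by
    gcongr
    norm_num
  nlinarith

/-- For every `η > 0` there is `N` such that for all `n ≥ N`, with `k = k₀(n) - 4` and
`M = f_n(k)`, in `G_{n,1/2}`: (i) the expected number of unordered pairs of distinct
`k`-cliques sharing at least two vertices is at most `(1+η)k⁴M²/(2n²)`; (ii) the
expected number of unordered triples of distinct `k`-cliques, pairwise sharing at least
two vertices, is at most `(1+η)·2k⁶M³/(3n⁴)`. -/
theorem stmt13 (η : ℝ) (hη : 0 < η) :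
    ∃ N : ℕ, ∀ n, N ≤ n →
      ((∑ G : SimpleGraph (Fin n), (overlapCount n (kZero n - 4) 2 G : ℝ)) /
            (Nat.card (SimpleGraph (Fin n)) : ℝ) ≤
          (1 + η) * ((kZero n - 4 : ℕ) : ℝ) ^ 4 * fExp n (kZero n - 4) ^ 2 /
            (2 * (n : ℝ) ^ 2)) ∧
      ((∑ G : SimpleGraph (Fin n), (overlapCount n (kZero n - 4) 3 G : ℝ)) /
            (Nat.card (SimpleGraph (Fin n)) : ℝ) ≤
          (1 + η) * 2 * ((kZero n - 4 : ℕ) : ℝ) ^ 6 * fExp n (kZero n - 4) ^ 3 /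
            (3 * (n : ℝ) ^ 4)) := by
  obtain ⟨c, hc⟩ := pow_unbounded_of_one_lt (max 4 (1 / η)) (one_lt_two (α := ℝ))
  have hc4 : (4 : ℝ) ≤ 2 ^ c := (le_max_left _ _).trans hc.le
  have hcη : 1 ≤ η * 2 ^ c := by
    have := (le_max_right 4 (1 / η)).trans hc.le
    rwa [div_le_iff₀' hη] at this
  obtain ⟨K, hK⟩ := exists_forall_le_two_pow_and_le c
  obtain ⟨N, hN⟩ := exists_le_kZero_sub_four K
  refine ⟨N, fun n hn => ?_⟩
  obtain ⟨h12, hKk⟩ := hN n hn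
  obtain ⟨s, hs, hsk⟩ := hK _ hKk
  obtain ⟨hk1, hkn, hup, hlow, hM⟩ := kZero_sub_four_bounds h12 rfl
  set k := kZero n - 4
  have hn0 : 0 < n := by omega
  have hnR : (0 : ℝ) < n := by exact_mod_cast hn0
  have hkR : (1 : ℝ) ≤ k := by exact_mod_cast hk1
  set δ : ℝ := errNum k s / (n : ℝ) ^ 3 with hδdef
  have hδ0 : 0 ≤ δ := by positivity
  have hext : ∀ a t x y, a ≤ k → 3 ≤ t + x + y → extWeight n k a t x y ≤ δ :=
    fun a t x y hak hu =>
      extWeight_le_errNum_div hk1 hkn hak hs (by omega) hup hlow hM hu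
  have herr : (2 : ℝ) ^ c * ((k + 1) ^ 3 * errNum k s) ≤ n := by
    exact_mod_cast two_pow_mul_errNum_le hs hsk hup
  have hδ : (2 : ℝ) ^ c * ((k + 1) ^ 3 * δ) ≤ 1 / (n : ℝ) ^ 2 := by
    calc (2 : ℝ) ^ c * ((k + 1) ^ 3 * δ) = 2 ^ c * ((k + 1) ^ 3 * errNum k s) / n ^ 3 := by
          rw [hδdef]
          ring
      _ ≤ n / (n : ℝ) ^ 3 := by gcongr
      _ = _ := by field_simp
  have hδ1 : (2 : ℝ) ^ c * ((k + 1) * δ) ≤ 1 / (n : ℝ) ^ 2 := by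
    refine le_trans ?_ hδ
    gcongr
    exact le_self_pow₀ (by linarith) (by norm_num)
  have hδ4 : 4 * (((k : ℝ) + 1) ^ 3 * δ) ≤ 1 / (n : ℝ) ^ 2 :=
    (mul_le_mul_of_nonneg_right hc4 (by positivity)).trans hδ
  have hδ41 : 4 * (((k : ℝ) + 1) * δ) ≤ 1 / (n : ℝ) ^ 2 :=
    (mul_le_mul_of_nonneg_right hc4 (by positivity)).trans hδ1
  have hg2 := extWeight_two_le_pow hkn hn0 (le_refl k)
  have hk2 : (1 : ℝ) ≤ (k : ℝ) ^ 2 := one_le_pow₀ hkR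
  have hk4 : (1 : ℝ) ≤ (k : ℝ) ^ 4 := one_le_pow₀ hkR
  have hM0 : 0 ≤ fExp n k := by
    unfold fExp
    positivity
  constructor
  · refine (expected_pairs_le n k).trans ?_
    have hsum := sum_extWeight_self_le (n := n) (k := k) (fun _ => 1) hδ0 zero_le_one
      (fun _ _ => le_rfl) le_rfl zero_le_one (fun t ht => hext k t 0 0 le_rfl (by omega))
    have herror : ((k : ℝ) + 1) * δ ≤ η * ((k : ℝ) ^ 4 / (n : ℝ) ^ 2) := by
      calc ((k : ℝ) + 1) * δ ≤ (η * 2 ^ c) * ((k + 1) * δ) :=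
            le_mul_of_one_le_left (by positivity) hcη
        _ = η * (2 ^ c * ((k + 1) * δ)) := by ring
        _ ≤ η * (1 / (n : ℝ) ^ 2) := by gcongr
        _ ≤ _ := by gcongr
    calc _ ≤ fExp n k ^ 2 * ((1 + η) * ((k : ℝ) ^ 4 / (n : ℝ) ^ 2)) / 2 := by
          gcongr
          linarith
      _ = _ := by
          field_simp
  · refine (expected_triples_le n k).trans ?_
    have hT : ∀ a ≤ k, extTotal n k a ≤ extWeight n k a 2 0 0 + (k + 1) ^ 3 * δ :=
      fun a hak => sum_extWeight_le hδ0 hak fun t x y hu => hext a t x y hak hu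
    have hT1 : ∀ a ≤ k, extTotal n k a ≤ 2 * ((k : ℝ) ^ 4 / (n : ℝ) ^ 2) := by
      intro a hak
      have h₁ := hT a hak
      have h₂ := extWeight_two_le_pow hkn hn0 hak
      have h₃ : 1 / (n : ℝ) ^ 2 ≤ (k : ℝ) ^ 4 / (n : ℝ) ^ 2 := by gcongr
      have h₄ : 0 ≤ ((k : ℝ) + 1) ^ 3 * δ := by positivity
      linarith
    have hk2' : 2 ≤ k := by omega
    have hT2 : extTotal n k 2 ≤ 3 * ((k : ℝ) ^ 2 / (n : ℝ) ^ 2) := by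
      have h₁ := hT 2 hk2'
      have h₂ := extWeight_two_le (a := 2) hkn hn0
      rw [Nat.choose_self, Nat.cast_one, one_mul, div_pow] at h₂
      have h₃ : 1 / (n : ℝ) ^ 2 ≤ (k : ℝ) ^ 2 / (n : ℝ) ^ 2 := by gcongr
      have h₄ : 0 ≤ ((k : ℝ) + 1) ^ 3 * δ := by positivity
      linarith
    have hsum := sum_extWeight_self_le (n := n) (k := k) (extTotal n k) hδ0
      (by positivity) hT1 hT2 (by positivity) (fun t ht => hext k t 0 0 le_rfl (by omega))
    have hmain : ∑ a ∈ Finset.range (k + 1),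
        (if 2 ≤ a then extWeight n k k a 0 0 * extTotal n k a else 0) ≤
          4 * ((k : ℝ) ^ 6 / (n : ℝ) ^ 4) := by
      refine hsum.trans ?_
      calc _ ≤ (k : ℝ) ^ 4 / (n : ℝ) ^ 2 * (3 * ((k : ℝ) ^ 2 / (n : ℝ) ^ 2)) +
            (4 * ((k + 1) * δ)) * ((k : ℝ) ^ 4 / (n : ℝ) ^ 2) := by
            have : 0 ≤ ((k : ℝ) + 1) * δ * ((k : ℝ) ^ 4 / (n : ℝ) ^ 2) := by positivity
            have := mul_le_mul_of_nonneg_right hg2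
              (show 0 ≤ 3 * ((k : ℝ) ^ 2 / (n : ℝ) ^ 2) by positivity)
            linarith
        _ ≤ (k : ℝ) ^ 4 / (n : ℝ) ^ 2 * (3 * ((k : ℝ) ^ 2 / (n : ℝ) ^ 2)) +
            ((k : ℝ) ^ 2 / (n : ℝ) ^ 2) * ((k : ℝ) ^ 4 / (n : ℝ) ^ 2) := by
            gcongr
            exact hδ41.trans (by gcongr)
        _ = _ := by
            field_simp
            ring
    calc _ ≤ fExp n k ^ 3 * (4 * ((k : ℝ) ^ 6 / (n : ℝ) ^ 4)) / 6 := by gcongr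
      _ = 1 * (2 * (k : ℝ) ^ 6 * fExp n k ^ 3 / (3 * (n : ℝ) ^ 4)) := by
          field_simp
          ring
      _ ≤ (1 + η) * (2 * (k : ℝ) ^ 6 * fExp n k ^ 3 / (3 * (n : ℝ) ^ 4)) := by
          gcongr
          linarith
      _ = _ := by ring
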